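/- Let k ≥ 1 and let L1, …, Lk be properly Lorentz-Minkowski norms on V all having the same cone domain A (so the same closure Ā in V ∖ {0} and the same boundary C = Ā ∖ A). Define L := (√L1 + ⋯ + √Lk)² on Ā (so L = 0 on C). Then: (a) L is smooth on Ā, in the sense that every point of Ā has an open neighborhood U in V and a C^∞ function L̃ : U → ℝ with L̃ = L on U ∩ Ā; and (b) for every such local C^∞ extension L̃ and every v ∈ U ∩ Ā, the fundamental tensor of L̃ at v is nondegenerate with index n−1. In particular, L is a properly Lorentz-Minkowski norm with cone domain A. -/

import Mathlib

open Set Module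

noncomputable section

variable {V : Type*} [NormedAddCommGroup V] [NormedSpace ℝ V]

/-- A subset of `V` is conic if stable under multiplication by positive scalars. -/
def Conic (s : Set V) : Prop := ∀ v ∈ s, ∀ c : ℝ, 0 < c → c • v ∈ s

/-- Positively 2-homogeneous on a set. -/
def PosHom2 (L : V → ℝ) (s : Set V) : Prop :=
  ∀ v ∈ s, ∀ c : ℝ, 0 < c → L (c • v) = c ^ 2 * L v

/-- The fundamental tensor of `L` at `v`: `g_v(u,w) = (1/2) D²L(v)(u,w)`. -/
def fundTensor (L : V → ℝ) (v u w : V) : ℝ :=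
  (1 / 2 : ℝ) * fderiv ℝ (fderiv ℝ L) v u w

/-- Lorentzian: nondegenerate and negative definite on a subspace of dimension `n-1`. -/
def IsLorentzForm (g : V → V → ℝ) : Prop :=
  (∀ u : V, (∀ w : V, g u w = 0) → u = 0) ∧
  ∃ W : Submodule ℝ V, finrank ℝ W = finrank ℝ V - 1 ∧
    ∀ u ∈ W, u ≠ 0 → g u u < 0

/-- A properly Lorentz-Minkowski norm on `V` with cone domain `A`. -/
structure IsProperLMNorm (L : V → ℝ) (A : Set V) : Prop where
  nonempty : A.Nonempty
  zero_not_mem : (0 : V) ∉ A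
  isOpen : IsOpen A
  isConnected : IsConnected A
  conic : Conic A
  pos : ∀ v ∈ A, 0 < L v
  zero_on_bd : ∀ v ∈ (closure A \ {0}) \ A, L v = 0
  smooth_ext : ∃ Astar : Set V, IsOpen Astar ∧ Conic Astar ∧ (0 : V) ∉ Astar ∧
    closure A \ {0} ⊆ Astar ∧ ContDiffOn ℝ (⊤ : ℕ∞) L Astar ∧ PosHom2 L Astar
  lorentz : ∀ v ∈ closure A \ {0}, IsLorentzForm (fundTensor L v)

open Filter Topology
open scoped ContDiff

theorem IsLorentzForm.neg_of_orthogonal [FiniteDimensional ℝ V] {T : V →L[ℝ] V →L[ℝ] ℝ}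
    (hs : ∀ u w, T u w = T w u) (h : IsLorentzForm (fun u w => (1 / 2 : ℝ) * T u w))
    {v u : V} (hv : v ≠ 0) (hvv : 0 ≤ T v v) (hvu : T v u = 0) (hu : ∀ c : ℝ, u ≠ c • v) :
    T u u < 0 := by
  obtain ⟨-, W, hW, hneg⟩ := h
  have hvW : v ∉ W := fun hm => by linarith [hneg v hm hv]
  have hlt : W < W ⊔ Submodule.span ℝ {v} := by
    refine lt_of_le_of_ne le_sup_left fun he => hvW ?_
    rw [he]
    exact Submodule.mem_sup_right (Submodule.mem_span_singleton_self v)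
  have htop : W ⊔ Submodule.span ℝ {v} = ⊤ := by
    apply Submodule.eq_top_of_finrank_eq
    have h1 := Submodule.finrank_lt_finrank_of_lt hlt
    have h2 := Submodule.finrank_le (W ⊔ Submodule.span ℝ {v})
    omega
  obtain ⟨w, hw, z, hz, hwz⟩ := Submodule.mem_sup.1 (htop ▸ Submodule.mem_top : u ∈ _)
  obtain ⟨c, rfl⟩ := Submodule.mem_span_singleton.1 hz
  have hw0 : w ≠ 0 := by
    rintro rfl
    exact hu c (by simpa using hwz.symm)
  have h1 := hneg w hw hw0
  obtain rfl : w = u - c • v := eq_sub_of_add_eq hwz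
  have h2 : T u v = 0 := by rw [hs, hvu]
  simp only [map_sub, map_smul, sub_apply, smul_apply,
    smul_eq_mul, hvu, h2] at h1
  nlinarith [mul_nonneg (mul_self_nonneg c) hvv]

theorem isLorentzForm_of_neg_of_orthogonal [FiniteDimensional ℝ V] {T : V →L[ℝ] V →L[ℝ] ℝ}
    (hs : ∀ u w, T u w = T w u) {v : V} (hvv : 0 ≤ T v v) (hv : T v ≠ 0)
    (hneg : ∀ u, T v u = 0 → (∀ c : ℝ, u ≠ c • v) → T u u < 0) :
    IsLorentzForm (fun u w => (1 / 2 : ℝ) * T u w) := by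
  have hneg' : ∀ u, T v u = 0 → 0 ≤ T u u → ∃ c : ℝ, u = c • v := by
    intro u h1 h2
    by_contra! h
    linarith [hneg u h1 h]
  constructor
  · intro u hu
    have hu' : ∀ w, T u w = 0 := fun w => by simpa using hu w
    obtain ⟨c, rfl⟩ := hneg' u (by rw [hs, hu']) (hu' u).ge
    by_cases hc : c = 0
    · simp [hc]
    · refine absurd (ContinuousLinearMap.ext fun w => ?_) hv
      simpa [hc] using hu' w
  · obtain ⟨v', h1, h2⟩ : ∃ v', 0 < T v' v' ∧ 0 < T v v' := by
      rcases hvv.lt_or_eq with h | h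
      · exact ⟨v, h, h⟩
      · obtain ⟨z, hz⟩ : ∃ z, T v z ≠ 0 := by
          by_contra! h
          exact hv (ContinuousLinearMap.ext h)
        obtain ⟨z, hz⟩ : ∃ z, 0 < T v z := by
          rcases lt_or_gt_of_ne hz with h | h
          · exact ⟨-z, by simpa using h⟩
          · exact ⟨z, h⟩
        set ε := T v z / (|T z z| + 1) with hε
        have hpos : 0 < |T z z| + 1 := by positivity
        have hεpos : 0 < ε := div_pos hz hpos
        have hεm : ε * (|T z z| + 1) = T v z := div_mul_cancel₀ _ hpos.ne'
        refine ⟨v + ε • z, ?_, ?_⟩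
        · simp only [map_add, map_smul, add_apply,
            smul_apply, smul_eq_mul, ← h, hs z v]
          have h3 : 0 ≤ |T z z| + T z z := by linarith [neg_abs_le (T z z)]
          nlinarith [mul_nonneg hεpos.le h3, mul_pos hεpos hz]
        · simp only [map_add, map_smul, smul_eq_mul, ← h]
          nlinarith [mul_pos hεpos hz]
    refine ⟨LinearMap.ker (T v').toLinearMap, ?_, ?_⟩
    · have := Module.Dual.finrank_ker_add_one_of_ne_zero (K := ℝ) (V₁ := V)
        (f := (T v').toLinearMap) (fun h0 => by
          have := LinearMap.congr_fun h0 v'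
          simp at this
          linarith)
      omega
    · intro u hu hu0
      have hu : T v' u = 0 := hu
      by_contra! hge
      have huu : 0 ≤ T u u := by linarith
      set x := T v v' • u - T v u • v' with hx
      have hxv : T v x = 0 := by simp [hx, mul_comm]
      have hxx : T x x = T v v' ^ 2 * T u u + T v u ^ 2 * T v' v' := by
        simp only [hx, map_sub, map_smul, sub_apply,
          smul_apply, smul_eq_mul, hs u v', hu]
        ring
      obtain ⟨c, hc⟩ := hneg' x hxv (by rw [hxx]; positivity)
      have hx0 : T x x = 0 := by
        rw [hc] at hxv ⊢
        simp only [map_smul, smul_apply, smul_eq_mul] at hxv ⊢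
        rw [hxv, mul_zero]
      have hvu : T v u = 0 := by
        have h3 : T v u ^ 2 * T v' v' = 0 := by
          nlinarith [mul_nonneg (sq_nonneg (T v v')) huu, mul_nonneg (sq_nonneg (T v u)) h1.le]
        simpa [h1.ne'] using h3
      obtain ⟨d, rfl⟩ := hneg' u hvu huu
      have : d * T v v' = 0 := by simpa [hs v' v] using hu
      have : d = 0 := by simpa [h2.ne'] using this
      exact hu0 (by simp [this])

theorem contDiff_parametric_integral [FiniteDimensional ℝ V] (n : ℕ) {h : ℝ × V → ℝ}
    (hh : ContDiff ℝ ∞ h) : ContDiff ℝ n (fun x => ∫ t in (0 : ℝ)..1, h (t, x)) := by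
  induction n generalizing h with
  | zero =>
    refine contDiff_zero.2 ?_
    exact intervalIntegral.continuous_parametric_intervalIntegral_of_continuous'
      (f := fun x t => h (t, x)) (by
        have := hh.continuous
        simp only [Function.uncurry_def]
        fun_prop) 0 1
  | succ n ih =>
    have hcf : Continuous (fderiv ℝ h) := hh.continuous_fderiv (by simp)
    set F' : V → ℝ → V →L[ℝ] ℝ := fun x t => (fderiv ℝ h (t, x)).comp
      (ContinuousLinearMap.inr ℝ ℝ V) with hF'
    have hF'c : Continuous (fun p : V × ℝ => F' p.1 p.2) := by
      simp only [hF']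
      fun_prop
    have hder : ∀ x, HasFDerivAt (fun x => ∫ t in (0 : ℝ)..1, h (t, x))
        (∫ t in (0 : ℝ)..1, F' x t) x := by
      intro x₀
      obtain ⟨C, hC⟩ := ((isCompact_closedBall x₀ 1).prod
        (isCompact_Icc (a := (0 : ℝ)) (b := 1))).exists_bound_of_continuousOn hF'c.continuousOn
      refine intervalIntegral.hasFDerivAt_integral_of_dominated_of_fderiv_le
        (F := fun x t => h (t, x)) (bound := fun _ => C)
        (Metric.ball_mem_nhds x₀ one_pos) ?_ ?_ ?_ ?_ ?_ ?_
      · refine Eventually.of_forall fun x => Continuous.aestronglyMeasurable ?_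
        have := hh.continuous
        fun_prop
      · refine Continuous.intervalIntegrable ?_ _ _
        have := hh.continuous
        fun_prop
      · refine Continuous.aestronglyMeasurable ?_
        exact hF'c.comp (by fun_prop : Continuous fun t : ℝ => (x₀, t))
      · refine Eventually.of_forall fun t ht x hx => ?_
        rw [uIoc_of_le zero_le_one] at ht
        exact hC (x, t) ⟨Metric.ball_subset_closedBall hx, ht.1.le, ht.2⟩
      · exact intervalIntegrable_const
      · refine Eventually.of_forall fun t ht x hx => ?_
        have h1 : HasFDerivAt h (fderiv ℝ h (t, x)) (t, x) :=
          (hh.differentiable (by simp) _).hasFDerivAt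
        exact h1.comp x (hasFDerivAt_prodMk_right t x)
    rw [Nat.cast_add, Nat.cast_one, contDiff_succ_iff_fderiv_apply]
    refine ⟨fun x => (hder x).differentiableAt, by simp, fun y => ?_⟩
    have : (fun x => fderiv ℝ (fun x => ∫ t in (0 : ℝ)..1, h (t, x)) x y) =
        fun x => ∫ t in (0 : ℝ)..1, (fun p : ℝ × V => fderiv ℝ h p (0, y)) (t, x) := by
      funext x
      rw [(hder x).fderiv, ContinuousLinearMap.intervalIntegral_apply]
      · simp [hF']
      · exact (hF'c.comp (by fun_prop : Continuous fun t : ℝ => (x, t))).intervalIntegrable _ _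
    rw [this]
    exact ih ((hh.fderiv_right (m := ∞) (by simp)).clm_apply contDiff_const)

/-- Hadamard's lemma for a function vanishing on an affine hyperplane. -/
theorem exists_contDiff_eq_mul_of_eq_zero [FiniteDimensional ℝ V] {l : V →L[ℝ] ℝ} {e v : V}
    (he : l e = 1) {g : V → ℝ} (hg : ContDiff ℝ ∞ g) (h0 : ∀ y, l (y - v) = 0 → g y = 0) :
    ∃ f : V → ℝ, ContDiff ℝ ∞ f ∧ ∀ y, g y = l (y - v) * f y := by
  set c : ℝ × V → V := fun p => p.2 - ((1 - p.1) * l (p.2 - v)) • e with hc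
  have hcs : ContDiff ℝ ∞ c := by
    simp only [hc]
    fun_prop
  set h : ℝ × V → ℝ := fun p => fderiv ℝ g (c p) e with hh
  have hhs : ContDiff ℝ ∞ h :=
    ((hg.fderiv_right (m := ∞) (by simp)).comp hcs).clm_apply contDiff_const
  refine ⟨fun y => ∫ t in (0 : ℝ)..1, h (t, y),
    contDiff_infty.2 fun n => contDiff_parametric_integral n hhs, fun y => ?_⟩
  have hd : ∀ t : ℝ, HasDerivAt (fun t => g (c (t, y))) (l (y - v) * h (t, y)) t := by
    intro t
    have h1 : HasDerivAt (fun t => c (t, y)) (l (y - v) • e) t := by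
      have h2 := ((((hasDerivAt_id t).const_sub 1).mul_const (l (y - v))).smul_const e).const_sub y
      exact h2.congr_deriv (by simp only [neg_mul, one_mul, neg_smul, neg_neg])
    have h2 := (hg.differentiable (by simp) (c (t, y))).hasFDerivAt.comp_hasDerivAt t h1
    exact h2.congr_deriv (by simp [hh])
  have hint := intervalIntegral.integral_eq_sub_of_hasDerivAt (a := 0) (b := 1)
    (fun t _ => hd t) (Continuous.intervalIntegrable (by
      have := hhs.continuous
      fun_prop) _ _)
  rw [intervalIntegral.integral_const_mul] at hint
  have h1 : c (1, y) = y := by simp [hc]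
  have h2 : g (c (0, y)) = 0 := h0 _ (by simp [hc, he])
  rw [hint, h1, h2, sub_zero]

/-- Local coordinates in which a function with nonvanishing differential becomes affine. -/
theorem exists_straightening [FiniteDimensional ℝ V] {p : V → ℝ} {U : Set V} {v : V}
    (hU : IsOpen U) (hv : v ∈ U) (hp : ContDiffOn ℝ ∞ p U) (hpv : p v = 0)
    (hdp : fderiv ℝ p v ≠ 0) :
    ∃ (Φ : OpenPartialHomeomorph V V) (l : V →L[ℝ] ℝ) (e : V), l e = 1 ∧ v ∈ Φ.source ∧
      Φ v = v ∧ Φ.source ⊆ U ∧ (∀ x ∈ Φ.source, p x = l (Φ x - v)) ∧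
      ContDiffOn ℝ ∞ Φ Φ.source ∧ ContDiffOn ℝ ∞ Φ.symm Φ.target := by
  set l := fderiv ℝ p v with hl
  obtain ⟨e, he⟩ : ∃ e, l e = 1 := by
    obtain ⟨z, hz⟩ : ∃ z, l z ≠ 0 := by
      by_contra! h
      exact hdp (ContinuousLinearMap.ext h)
    exact ⟨(l z)⁻¹ • z, by simp [hz]⟩
  set φ : V → V := fun x => x + (p x - l (x - v)) • e with hφ
  have hφv : φ v = v := by simp [hφ, hpv]
  have hφs : ContDiffOn ℝ ∞ φ U := by
    simp only [hφ]
    fun_prop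
  have hφat : ∀ x ∈ U, ContDiffAt ℝ ∞ φ x := fun x hx => hφs.contDiffAt (hU.mem_nhds hx)
  have hpd : HasFDerivAt p l v :=
    ((hp.contDiffAt (hU.mem_nhds hv)).differentiableAt (by simp)).hasFDerivAt
  have hφd : HasFDerivAt φ ((ContinuousLinearEquiv.refl ℝ V : V ≃L[ℝ] V) : V →L[ℝ] V) v := by
    have h1 := (hasFDerivAt_id v).add ((hpd.sub (l.hasFDerivAt.comp v
      ((hasFDerivAt_id v).sub_const v))).smul_const e)
    refine h1.congr_fderiv ?_
    ext x
    simp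
  have hcont : ContinuousOn (fderiv ℝ φ) U := hφs.continuousOn_fderiv_of_isOpen hU (by simp)
  have hopen : IsOpen (U ∩ fderiv ℝ φ ⁻¹' range ((↑) : (V ≃L[ℝ] V) → V →L[ℝ] V)) :=
    hcont.isOpen_inter_preimage hU ContinuousLinearEquiv.isOpen
  set S := U ∩ fderiv ℝ φ ⁻¹' range ((↑) : (V ≃L[ℝ] V) → V →L[ℝ] V) with hS
  set Φ₀ := (hφat v hv).toOpenPartialHomeomorph φ hφd (by simp) with hΦ₀
  have hvS : v ∈ S := ⟨hv, ContinuousLinearEquiv.refl ℝ V, hφd.fderiv.symm⟩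
  refine ⟨Φ₀.restrOpen S hopen, l, e, he, ?_, hφv, ?_, ?_, ?_, ?_⟩
  · exact ⟨(hφat v hv).mem_toOpenPartialHomeomorph_source hφd (by simp), hvS⟩
  · exact fun x hx => hx.2.1
  · intro x hx
    change p x = l (φ x - v)
    simp only [hφ, map_sub, map_add, map_smul, smul_eq_mul, he]
    ring
  · exact hφs.mono fun x hx => hx.2.1
  · intro y hy
    have hys := (Φ₀.restrOpen S hopen).map_target hy
    obtain ⟨hyU, E, hE⟩ := hys.2
    refine ((Φ₀.restrOpen S hopen).contDiffAt_symm (f₀' := E) hy ?_ (hφat _ hyU)).contDiffWithinAt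
    rw [hE]
    exact ((hφat _ hyU).differentiableAt (by simp)).hasFDerivAt

/-- Two smooth functions which are positive on an open set `A` and vanish to exactly first order
at its boundary have, near each boundary point, a positive smooth quotient. -/
theorem exists_contDiffOn_pos_quotient [FiniteDimensional ℝ V] {p q : V → ℝ} {A U : Set V} {v : V}
    (hU : IsOpen U) (hvU : v ∈ U) (hp : ContDiffOn ℝ ∞ p U) (hq : ContDiffOn ℝ ∞ q U)
    (hA : IsOpen A) (hv : v ∈ closure A) (hvA : v ∉ A) (hpA : ∀ x ∈ A, 0 < p x)
    (hqA : ∀ x ∈ A, 0 < q x) (hpC : ∀ x ∈ U ∩ (closure A \ A), p x = 0)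
    (hqC : ∀ x ∈ U ∩ (closure A \ A), q x = 0)
    (hdp : fderiv ℝ p v ≠ 0) (hdq : fderiv ℝ q v ≠ 0) :
    ∃ (W : Set V) (f : V → ℝ), IsOpen W ∧ v ∈ W ∧ ContDiffOn ℝ ∞ f W ∧ (∀ x ∈ W, 0 < f x) ∧
      ∀ x ∈ W, q x = f x * p x := by
  have hpv : p v = 0 := hpC v ⟨hvU, hv, hvA⟩
  have hqv : q v = 0 := hqC v ⟨hvU, hv, hvA⟩
  obtain ⟨Φ, l, e, he, hvs, hΦv, hsU, hpl, hΦ, hΨ⟩ := exists_straightening hU hvU hp hpv hdp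
  have hvt : v ∈ Φ.target := hΦv ▸ Φ.map_source hvs
  obtain ⟨r, hr, hball⟩ := Metric.isOpen_iff.1 Φ.open_target v hvt
  -- the positive side of the wall lies in `A`
  set P := Metric.ball v r ∩ {y | 0 < l (y - v)} with hP
  have hPconv : Convex ℝ P := by
    refine (convex_ball v r).inter ?_
    have : {y | 0 < l (y - v)} = {y | l v < l.toLinearMap y} := by
      ext y
      simp
    rw [this]
    exact convex_halfSpace_gt l.toLinearMap.isLinear (l v)
  have hPt : P ⊆ Φ.target := fun y hy => hball hy.1
  have hppos : ∀ y ∈ P, 0 < p (Φ.symm y) := fun y hy => by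
    rw [hpl _ (Φ.map_target (hPt hy)), Φ.right_inv (hPt hy)]
    exact hy.2
  have hQ : Φ.symm '' P ⊆ A := by
    refine IsPreconnected.subset_of_closure_inter_subset
      (hPconv.isPreconnected.image _ (Φ.continuousOn_symm.mono hPt)) hA ?_ ?_
    · have h1 : Φ.source ∩ Φ ⁻¹' Metric.ball v r ∈ 𝓝 v :=
        (Φ.isOpen_inter_preimage Metric.isOpen_ball).mem_nhds
          ⟨hvs, by simpa [hΦv] using hr⟩
      obtain ⟨x, ⟨hxs, hxb⟩, hxA⟩ := mem_closure_iff_nhds.1 hv _ h1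
      refine ⟨x, ⟨Φ x, ⟨hxb, ?_⟩, Φ.left_inv hxs⟩, hxA⟩
      have := hpA x hxA
      rwa [hpl x hxs] at this
    · rintro _ ⟨hx, y, hy, rfl⟩
      by_contra hn
      exact (hppos y hy).ne' (hpC _ ⟨hsU (Φ.map_target (hPt hy)), hx, hn⟩)
  have hzero : ∀ y ∈ Metric.ball v r, l (y - v) = 0 → q (Φ.symm y) = 0 := by
    intro y hy hly
    have hyt := hball hy
    have hys := Φ.map_target hyt
    refine hqC _ ⟨hsU hys, ?_, fun hm => (hpA _ hm).ne' ?_⟩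
    · have hc : Tendsto (fun t : ℝ => y + t • e) (𝓝[>] 0) (𝓝 y) := by
        have : Tendsto (fun t : ℝ => y + t • e) (𝓝 0) (𝓝 (y + (0 : ℝ) • e)) :=
          Continuous.tendsto (by fun_prop) 0
        simpa using this.mono_left nhdsWithin_le_nhds
      refine mem_closure_of_tendsto ((Φ.continuousAt_symm hyt).tendsto.comp hc) ?_
      filter_upwards [hc.eventually_mem (Metric.isOpen_ball.mem_nhds hy), self_mem_nhdsWithin]
        with t ht ht0
      refine hQ ⟨_, ⟨ht, ?_⟩, rfl⟩
      have : l (y + t • e - v) = t := by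
        rw [add_sub_right_comm, map_add, hly]
        simp [he]
      rw [mem_ofPred_eq, this]
      exact ht0
    · rw [hpl _ hys, Φ.right_inv hyt, hly]
  -- divide in the straightened coordinates
  let χ : ContDiffBump v := ⟨r / 4, r / 2, by positivity, by linarith⟩
  set g : V → ℝ := fun y => χ y * q (Φ.symm y) with hg
  have hqΨ : ∀ y ∈ Metric.ball v r, ContDiffAt ℝ ∞ (fun y => q (Φ.symm y)) y := by
    intro y hy
    have h1 := hball hy
    exact ((hq.contDiffAt (hU.mem_nhds (hsU (Φ.map_target h1)))).comp y
      (hΨ.contDiffAt (Φ.open_target.mem_nhds h1)))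
  have hχ0 : ∀ y, y ∉ Metric.ball v (r / 2) → χ y = 0 := fun y hy => by
    by_contra h
    have h1 : y ∈ Function.support χ := h
    rw [χ.support_eq] at h1
    exact hy h1
  have hgs : ContDiff ℝ ∞ g := by
    refine contDiff_iff_contDiffAt.2 fun y => ?_
    by_cases hy : y ∈ Metric.ball v r
    · exact χ.contDiffAt.mul (hqΨ y hy)
    · have h1 : (Metric.closedBall v (r / 2))ᶜ ∈ 𝓝 y :=
        Metric.isClosed_closedBall.isOpen_compl.mem_nhds fun h =>
          hy (Metric.closedBall_subset_ball (by linarith) h)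
      refine (contDiffAt_const (c := (0 : ℝ))).congr_of_eventuallyEq ?_
      filter_upwards [h1] with z hz
      simp [hg, hχ0 z fun h => hz (Metric.ball_subset_closedBall h)]
  obtain ⟨f, hf, hgf⟩ := exists_contDiff_eq_mul_of_eq_zero he (v := v) hgs (fun y hy => by
    by_cases h : y ∈ Metric.ball v r
    · simp [hg, hzero y h hy]
    · simp [hg, hχ0 y fun h' => h (Metric.ball_subset_ball (by linarith) h')])
  set W := Φ.source ∩ Φ ⁻¹' Metric.ball v (r / 4) with hW
  have hWo : IsOpen W := Φ.isOpen_inter_preimage Metric.isOpen_ball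
  have hvW : v ∈ W := ⟨hvs, by simpa [hΦv] using hr⟩
  have hfW : ContDiffOn ℝ ∞ (fun x => f (Φ x)) W :=
    hf.comp_contDiffOn (hΦ.mono inter_subset_left)
  have heq : ∀ x ∈ W, q x = f (Φ x) * p x := by
    intro x hx
    have h1 := hgf (Φ x)
    have h2 : χ (Φ x) = 1 := χ.one_of_mem_closedBall (Metric.ball_subset_closedBall hx.2)
    rw [← hpl x hx.1] at h1
    simp only [hg, h2, Φ.left_inv hx.1, one_mul] at h1
    rw [h1, mul_comm]
  have hfv : 0 < f (Φ v) := by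
    have hcont : ContinuousAt (fun x => f (Φ x)) v := hfW.continuousOn.continuousAt
      (hWo.mem_nhds hvW)
    have hge : 0 ≤ f (Φ v) := by
      by_contra! hlt
      obtain ⟨x, ⟨hxW, hx⟩, hxA⟩ := mem_closure_iff_nhds.1 hv _
        (inter_mem (hWo.mem_nhds hvW) (hcont.eventually_lt_const hlt))
      have h1 := heq x hxW
      have h2 := mul_neg_of_neg_of_pos hx (hpA x hxA)
      linarith [hqA x hxA]
    refine hge.lt_of_ne' fun h0 => hdq ?_
    have h1 : HasFDerivAt (fun x => f (Φ x) * p x)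
        (f (Φ v) • fderiv ℝ p v + p v • fderiv ℝ (fun x => f (Φ x)) v) v :=
      ((hfW.contDiffAt (hWo.mem_nhds hvW)).differentiableAt (by simp)).hasFDerivAt.mul
        ((hp.contDiffAt (hU.mem_nhds hvU)).differentiableAt (by simp)).hasFDerivAt
    rw [h0, hpv, zero_smul, zero_smul, add_zero] at h1
    exact (h1.congr_of_eventuallyEq
      (eventually_of_mem (hWo.mem_nhds hvW) heq)).fderiv
  refine ⟨W ∩ (fun x => f (Φ x)) ⁻¹' Ioi 0, fun x => f (Φ x),
    hfW.continuousOn.isOpen_inter_preimage hWo isOpen_Ioi, ⟨hvW, hfv⟩,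
    hfW.mono inter_subset_left, fun x hx => hx.2, fun x hx => heq x hx.1⟩

theorem minSmoothness_two_le_infty : minSmoothness ℝ 2 ≤ ∞ := by
  rw [minSmoothness_of_isRCLikeNormedField]
  exact WithTop.coe_le_coe.2 (le_top : (2 : ℕ∞) ≤ ⊤)

theorem fderiv_apply_self_of_posHom2 {P : V → ℝ} {S : Set V} (hS : IsOpen S)
    (hP : ContDiffOn ℝ ∞ P S) (hh : PosHom2 P S) {v : V} (hv : v ∈ S) :
    fderiv ℝ P v v = 2 * P v := by
  have h1 : HasFDerivAt P (fderiv ℝ P v) ((1 : ℝ) • v) := by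
    rw [one_smul]
    exact ((hP.contDiffAt (hS.mem_nhds hv)).differentiableAt (by simp)).hasFDerivAt
  have h2 : HasDerivAt (fun c : ℝ => P (c • v)) (fderiv ℝ P v ((1 : ℝ) • v)) 1 :=
    h1.comp_hasDerivAt (1 : ℝ) ((hasDerivAt_id (1 : ℝ)).smul_const v)
  have h3 : HasDerivAt (fun c : ℝ => c ^ 2 * P v) (2 * P v) 1 := by
    simpa using (hasDerivAt_pow 2 (1 : ℝ)).mul_const (P v)
  have h4 : (fun c : ℝ => P (c • v)) =ᶠ[𝓝 1] fun c => c ^ 2 * P v := by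
    filter_upwards [eventually_gt_nhds (zero_lt_one (α := ℝ))] with c hc using hh v hv c hc
  rw [one_smul] at h2
  exact h2.unique (h3.congr_of_eventuallyEq h4)

theorem fderiv_fderiv_apply_self_of_posHom2 {P : V → ℝ} {S : Set V} (hS : IsOpen S)
    (hc : Conic S) (hP : ContDiffOn ℝ ∞ P S) (hh : PosHom2 P S) {v : V} (hv : v ∈ S) :
    fderiv ℝ (fderiv ℝ P) v v = fderiv ℝ P v := by
  have hd : ∀ x ∈ S, HasFDerivAt P (fderiv ℝ P x) x := fun x hx =>
    ((hP.contDiffAt (hS.mem_nhds hx)).differentiableAt (by simp)).hasFDerivAt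
  have hhom : ∀ c : ℝ, 0 < c → fderiv ℝ P (c • v) = c • fderiv ℝ P v := by
    intro c hc0
    have h1 : HasFDerivAt (fun x => P (c • x)) (c • fderiv ℝ P (c • v)) v := by
      refine ((hd _ (hc v hv c hc0)).comp v ((hasFDerivAt_id v).const_smul c)).congr_fderiv ?_
      ext x
      simp
    have h2 : HasFDerivAt (fun x => P (c • x)) (c ^ 2 • fderiv ℝ P v) v := by
      refine ((hd v hv).const_mul (c ^ 2)).congr_of_eventuallyEq ?_
      filter_upwards [hS.mem_nhds hv] with x hx using hh x hx c hc0
    have h3 := h1.unique h2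
    rw [pow_two, mul_smul] at h3
    exact smul_right_injective _ hc0.ne' h3
  have h1 : HasFDerivAt (fderiv ℝ P) (fderiv ℝ (fderiv ℝ P) v) ((1 : ℝ) • v) := by
    rw [one_smul]
    exact (((hP.contDiffAt (hS.mem_nhds hv)).fderiv_right (m := ∞) (by simp)).differentiableAt
      (by simp)).hasFDerivAt
  have h2 : HasDerivAt (fun c : ℝ => fderiv ℝ P (c • v))
      (fderiv ℝ (fderiv ℝ P) v ((1 : ℝ) • v)) 1 :=
    h1.comp_hasDerivAt (1 : ℝ) ((hasDerivAt_id (1 : ℝ)).smul_const v)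
  have h3 : HasDerivAt (fun c : ℝ => c • fderiv ℝ P v) ((1 : ℝ) • fderiv ℝ P v) 1 :=
    (hasDerivAt_id (1 : ℝ)).smul_const (fderiv ℝ P v)
  have h4 : (fun c : ℝ => fderiv ℝ P (c • v)) =ᶠ[𝓝 1] fun c => c • fderiv ℝ P v := by
    filter_upwards [eventually_gt_nhds (zero_lt_one (α := ℝ))] with c hc using hhom c hc
  rw [one_smul] at h2 h3
  exact h2.unique (h3.congr_of_eventuallyEq h4)

theorem ContDiffAt.eventually_hasFDerivAt {p : V → ℝ} {v : V} (hp : ContDiffAt ℝ ∞ p v) :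
    ∀ᶠ x in 𝓝 v, HasFDerivAt p (fderiv ℝ p x) x := by
  filter_upwards [(hp.of_le (m := 1) (by simp)).eventually (by simp)] with x hx
  exact (hx.differentiableAt (by simp)).hasFDerivAt

theorem ContDiffAt.hasFDerivAt_fderiv {p : V → ℝ} {v : V} (hp : ContDiffAt ℝ ∞ p v) :
    HasFDerivAt (fderiv ℝ p) (fderiv ℝ (fderiv ℝ p) v) v :=
  ((hp.fderiv_right (m := ∞) (by simp)).differentiableAt (by simp)).hasFDerivAt

theorem fderiv_fderiv_mul_apply {p q : V → ℝ} {v : V} (hp : ContDiffAt ℝ ∞ p v)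
    (hq : ContDiffAt ℝ ∞ q v) (u : V) :
    fderiv ℝ (fderiv ℝ (fun x => p x * q x)) v u u = p v * fderiv ℝ (fderiv ℝ q) v u u +
      2 * (fderiv ℝ p v u * fderiv ℝ q v u) + q v * fderiv ℝ (fderiv ℝ p) v u u := by
  have h1 : fderiv ℝ (fun x => p x * q x) =ᶠ[𝓝 v]
      fun x => p x • fderiv ℝ q x + q x • fderiv ℝ p x := by
    filter_upwards [hp.eventually_hasFDerivAt, hq.eventually_hasFDerivAt] with x h1 h2
    exact (h1.mul h2).fderiv
  have h2 := (hp.eventually_hasFDerivAt.self_of_nhds.fun_smul hq.hasFDerivAt_fderiv).fun_add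
    (hq.eventually_hasFDerivAt.self_of_nhds.fun_smul hp.hasFDerivAt_fderiv)
  rw [h1.fderiv_eq, h2.fderiv]
  simp
  ring

theorem fderiv_fderiv_sum_apply {ι : Type*} [Fintype ι] {F : ι → V → ℝ} {v : V}
    (hF : ∀ j, ContDiffAt ℝ ∞ (F j) v) (u : V) :
    fderiv ℝ (fderiv ℝ (fun x => ∑ j, F j x)) v u u = ∑ j, fderiv ℝ (fderiv ℝ (F j)) v u u := by
  have h1 : fderiv ℝ (fun x => ∑ j, F j x) =ᶠ[𝓝 v] fun x => ∑ j, fderiv ℝ (F j) x := by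
    filter_upwards [eventually_all.2 fun j => (hF j).eventually_hasFDerivAt] with x hx
    exact (HasFDerivAt.fun_sum fun j _ => hx j).fderiv
  rw [h1.fderiv_eq, (HasFDerivAt.fun_sum fun j _ => (hF j).hasFDerivAt_fderiv).fderiv]
  simp

namespace IsProperLMNorm

variable {L : V → ℝ} {A : Set V} {v : V}

theorem contDiffAt (h : IsProperLMNorm L A) (hv : v ∈ closure A \ {0}) : ContDiffAt ℝ ∞ L v := by
  obtain ⟨S, hS, -, -, hAS, hL, -⟩ := h.smooth_ext
  exact hL.contDiffAt (hS.mem_nhds (hAS hv))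

theorem fderiv_apply_self (h : IsProperLMNorm L A) (hv : v ∈ closure A \ {0}) :
    fderiv ℝ L v v = 2 * L v := by
  obtain ⟨S, hS, -, -, hAS, hL, hh⟩ := h.smooth_ext
  exact fderiv_apply_self_of_posHom2 hS hL hh (hAS hv)

theorem fderiv_fderiv_apply_self (h : IsProperLMNorm L A) (hv : v ∈ closure A \ {0}) :
    fderiv ℝ (fderiv ℝ L) v v = fderiv ℝ L v := by
  obtain ⟨S, hS, hc, -, hAS, hL, hh⟩ := h.smooth_ext
  exact fderiv_fderiv_apply_self_of_posHom2 hS hc hL hh (hAS hv)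

theorem fderiv_ne_zero (h : IsProperLMNorm L A) (hv : v ∈ closure A \ {0}) :
    fderiv ℝ L v ≠ 0 := by
  intro h0
  refine hv.2 ((h.lorentz v hv).1 v fun w => ?_)
  simp [fundTensor, h.fderiv_fderiv_apply_self hv, h0]

theorem mem_of_mem (h : IsProperLMNorm L A) (hv : v ∈ A) : v ∈ closure A \ {0} :=
  ⟨subset_closure hv, fun h0 => h.zero_not_mem (mem_singleton_iff.1 h0 ▸ hv)⟩

theorem nonneg (h : IsProperLMNorm L A) (hv : v ∈ closure A \ {0}) : 0 ≤ L v := by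
  by_cases hA : v ∈ A
  · exact (h.pos v hA).le
  · exact (h.zero_on_bd v ⟨hv, hA⟩).ge

theorem fderiv_fderiv_apply_neg [FiniteDimensional ℝ V] (h : IsProperLMNorm L A)
    (hv : v ∈ closure A \ {0}) {u : V} (hvu : fderiv ℝ L v u = 0) (hu : ∀ c : ℝ, u ≠ c • v) :
    fderiv ℝ (fderiv ℝ L) v u u < 0 := by
  refine IsLorentzForm.neg_of_orthogonal
    (fun a b => ((h.contDiffAt hv).isSymmSndFDerivAt minSmoothness_two_le_infty) a b)
    (h.lorentz v hv) hv.2 ?_ ?_ hu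
  · rw [h.fderiv_fderiv_apply_self hv, h.fderiv_apply_self hv]
    linarith [h.nonneg hv]
  · rw [h.fderiv_fderiv_apply_self hv, hvu]

theorem contDiffAt_sqrt (h : IsProperLMNorm L A) (hv : v ∈ A) :
    ContDiffAt ℝ ∞ (fun x => √(L x)) v :=
  (h.contDiffAt (h.mem_of_mem hv)).sqrt (ne_of_gt (h.pos v hv))

/-- The square root of a Lorentz-Minkowski norm is strictly concave transversally to rays. -/
theorem fderiv_fderiv_sqrt_neg [FiniteDimensional ℝ V] (h : IsProperLMNorm L A) (hv : v ∈ A)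
    {u : V} (hu : ∀ c : ℝ, u ≠ c • v) :
    fderiv ℝ (fderiv ℝ (fun x => √(L x))) v u u < 0 := by
  have hv' := h.mem_of_mem hv
  have hF := h.contDiffAt_sqrt hv
  set F : V → ℝ := fun x => √(L x) with hFdef
  have hFv : 0 < F v := Real.sqrt_pos.2 (h.pos v hv)
  have hLF : L =ᶠ[𝓝 v] fun x => F x * F x := by
    filter_upwards [h.isOpen.mem_nhds hv] with x hx
    exact (Real.mul_self_sqrt (h.pos x hx).le).symm
  have hF1 := hF.eventually_hasFDerivAt.self_of_nhds
  have hdL : ∀ w, fderiv ℝ L v w = 2 * F v * fderiv ℝ F v w := fun w => by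
    rw [hLF.fderiv_eq, (hF1.fun_mul hF1).fderiv]
    simp
    ring
  have hddL := fderiv_fderiv_mul_apply hF hF u
  rw [← hLF.fderiv.fderiv_eq] at hddL
  set T := fderiv ℝ (fderiv ℝ L) v with hT
  have hLv : L v = F v * F v := hLF.self_of_nhds
  set c := fderiv ℝ F v u / F v with hc
  have hcF : c * F v = fderiv ℝ F v u := div_mul_cancel₀ _ hFv.ne'
  have hvv : fderiv ℝ L v v = 2 * (F v * F v) := by rw [h.fderiv_apply_self hv', hLv]
  have hperp : fderiv ℝ L v (u - c • v) = 0 := by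
    rw [map_sub, map_smul, smul_eq_mul, hvv, hdL, ← hcF]
    ring
  have hneg := h.fderiv_fderiv_apply_neg hv' hperp (fun d hd => hu (d + c) (by
    rw [add_smul, ← hd, sub_add_cancel]))
  rw [← hT] at hneg
  have hTv : T v = fderiv ℝ L v := h.fderiv_fderiv_apply_self hv'
  have hTuv : T u v = fderiv ℝ L v u := by
    rw [← hTv]
    exact ((h.contDiffAt hv').isSymmSndFDerivAt minSmoothness_two_le_infty) u v
  have hexp : T (u - c • v) (u - c • v) = 2 * F v * fderiv ℝ (fderiv ℝ F) v u u := by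
    simp only [map_sub, map_smul, sub_apply, smul_apply, smul_eq_mul, hTuv, hTv, hvv, hddL, hdL]
    rw [← hcF]
    ring
  rw [hexp] at hneg
  nlinarith

/-- Proper Lorentz-Minkowski norms with the same cone domain have locally smooth positive
quotients, up to the boundary of the cone. -/
theorem exists_quotient [FiniteDimensional ℝ V] {L' : V → ℝ} (h : IsProperLMNorm L A)
    (h' : IsProperLMNorm L' A) (hv : v ∈ closure A \ {0}) :
    ∃ (W : Set V) (f : V → ℝ), IsOpen W ∧ v ∈ W ∧ ContDiffOn ℝ ∞ f W ∧ (∀ x ∈ W, 0 < f x) ∧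
      ∀ x ∈ W, L' x = f x * L x := by
  by_cases hvA : v ∈ A
  · refine ⟨A, fun x => L' x / L x, h.isOpen, hvA, fun x hx => ?_,
      fun x hx => div_pos (h'.pos x hx) (h.pos x hx),
      fun x hx => (div_mul_cancel₀ _ (h.pos x hx).ne').symm⟩
    exact ((h'.contDiffAt (h.mem_of_mem hx)).div (h.contDiffAt (h.mem_of_mem hx))
      (h.pos x hx).ne').contDiffWithinAt
  · obtain ⟨S, hS, -, h0, hAS, hL, -⟩ := h.smooth_ext
    obtain ⟨S', hS', -, -, hAS', hL', -⟩ := h'.smooth_ext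
    have hmem : ∀ x ∈ (S ∩ S') ∩ (closure A \ A), x ∈ (closure A \ {0}) \ A := fun x hx =>
      ⟨⟨hx.2.1, fun hx0 => h0 (mem_singleton_iff.1 hx0 ▸ hx.1.1)⟩, hx.2.2⟩
    exact exists_contDiffOn_pos_quotient (hS.inter hS') ⟨hAS hv, hAS' hv⟩
      (hL.mono inter_subset_left) (hL'.mono inter_subset_right) h.isOpen hv.1 hvA h.pos h'.pos
      (fun x hx => h.zero_on_bd x (hmem x hx)) (fun x hx => h'.zero_on_bd x (hmem x hx))
      (h.fderiv_ne_zero hv) (h'.fderiv_ne_zero hv)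

end IsProperLMNorm

theorem ContDiffOn.isLorentzForm_of_eqOn {N M : V → ℝ} {A S U : Set V} (hA : IsOpen A)
    (hS : IsOpen S) (hU : IsOpen U) (hN : ContDiffOn ℝ ∞ N S) (hM : ContDiffOn ℝ ∞ M U)
    {v : V} (hvS : v ∈ S) (hvU : v ∈ U) (hvA : v ∈ closure A)
    (heq : EqOn M N ((S ∩ U) ∩ A)) (h : IsLorentzForm (fundTensor N v)) :
    IsLorentzForm (fundTensor M v) := by
  have ho := hS.inter hU
  have hc : ∀ {P : V → ℝ}, ContDiffOn ℝ ∞ P (S ∩ U) →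
      ContinuousOn (fderiv ℝ (fderiv ℝ P)) ((S ∩ U) ∩ closure A) := fun hP =>
    ((hP.fderiv_of_isOpen (m := ∞) ho (by simp)).continuousOn_fderiv_of_isOpen ho (by simp)).mono
      inter_subset_left
  have h1 : EqOn (fderiv ℝ (fderiv ℝ M)) (fderiv ℝ (fderiv ℝ N)) ((S ∩ U) ∩ A) := fun x hx =>
    (heq.eventuallyEq_of_mem ((ho.inter hA).mem_nhds hx)).fderiv.fderiv_eq
  have h2 := h1.of_subset_closure (hc (hM.mono inter_subset_right)) (hc (hN.mono inter_subset_left))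
    (inter_subset_inter_right _ subset_closure) ho.inter_closure
  have h3 : fundTensor M v = fundTensor N v := by
    funext a b
    simp only [fundTensor, h2 ⟨⟨hvS, hvU⟩, hvA⟩]
  rwa [h3]

/-- The candidate for the squared sum of the roots of the norms `Lf j`, written in terms of
quotients by a reference norm `Lf i` so that it stays smooth across the boundary of the cone. -/
def rootSumSq {ι : Type*} [Fintype ι] (Lf : ι → V → ℝ) (i : ι) (v : V) : ℝ :=
  (∑ j, √(Lf j v / Lf i v)) ^ 2 * Lf i v

namespace rootSumSq

variable {ι : Type*} [Fintype ι] {Lf : ι → V → ℝ} {A : Set V} {v : V}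

theorem eq_of_mem (hLf : ∀ j, IsProperLMNorm (Lf j) A) (i : ι) (hv : v ∈ closure A \ {0}) :
    rootSumSq Lf i v = (∑ j, √(Lf j v)) ^ 2 := by
  by_cases hA : v ∈ A
  · have hpos := (hLf i).pos v hA
    have h1 : ∀ j, √(Lf j v / Lf i v) = √(Lf j v) / √(Lf i v) := fun j =>
      Real.sqrt_div ((hLf j).pos v hA).le _
    simp only [rootSumSq, h1, ← Finset.sum_div, div_pow, Real.sq_sqrt hpos.le]
    exact div_mul_cancel₀ _ hpos.ne'
  · have h0 : ∀ j, Lf j v = 0 := fun j => (hLf j).zero_on_bd v ⟨hv, hA⟩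
    simp [rootSumSq, h0]

theorem exists_eq_mul [FiniteDimensional ℝ V] (hLf : ∀ j, IsProperLMNorm (Lf j) A) (i : ι)
    (hv : v ∈ closure A \ {0}) :
    ∃ (W : Set V) (H : V → ℝ), IsOpen W ∧ v ∈ W ∧ ContDiffOn ℝ ∞ H W ∧ 0 < H v ∧
      ∀ x ∈ W, rootSumSq Lf i x = H x * Lf i x := by
  choose W f hW hvW hf hpos heq using fun j => (hLf i).exists_quotient (hLf j) hv
  refine ⟨⋂ j, W j, fun x => (∑ j, √(f j x)) ^ 2, isOpen_iInter_of_finite hW,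
    mem_iInter.2 hvW, ?_, ?_, fun x hx => ?_⟩
  · refine ContDiffOn.pow (ContDiffOn.sum fun j _ => ?_) 2
    exact ((hf j).mono (iInter_subset W j)).sqrt fun x hx => (hpos j x (mem_iInter.1 hx j)).ne'
  · have := Finset.sum_pos (s := Finset.univ) (fun j _ => Real.sqrt_pos.2 (hpos j v (hvW j)))
      ⟨i, Finset.mem_univ i⟩
    positivity
  · by_cases h0 : Lf i x = 0
    · simp [rootSumSq, h0]
    · have h1 : ∀ j, Lf j x / Lf i x = f j x := fun j => by
        rw [heq j x (mem_iInter.1 hx j), mul_div_cancel_right₀ _ h0]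
      simp only [rootSumSq, h1]

theorem exists_contDiffOn [FiniteDimensional ℝ V] (hLf : ∀ j, IsProperLMNorm (Lf j) A) (i : ι)
    (hv : v ∈ closure A \ {0}) :
    ∃ U : Set V, IsOpen U ∧ v ∈ U ∧ ContDiffOn ℝ ∞ (rootSumSq Lf i) U := by
  obtain ⟨W, H, hW, hvW, hH, -, heq⟩ := exists_eq_mul hLf i hv
  obtain ⟨S, hS, -, -, hAS, hL, -⟩ := (hLf i).smooth_ext
  exact ⟨W ∩ S, hW.inter hS, ⟨hvW, hAS hv⟩,
    ((hH.mono inter_subset_left).mul (hL.mono inter_subset_right)).congr fun x hx => heq x hx.1⟩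

theorem exists_smooth_ext [FiniteDimensional ℝ V] (hLf : ∀ j, IsProperLMNorm (Lf j) A) (i : ι) :
    ∃ S : Set V, IsOpen S ∧ Conic S ∧ (0 : V) ∉ S ∧ closure A \ {0} ⊆ S ∧
      ContDiffOn ℝ ∞ (rootSumSq Lf i) S ∧ PosHom2 (rootSumSq Lf i) S := by
  choose S hS hSc hS0 hAS hL hh using fun j => (hLf j).smooth_ext
  have hI : IsOpen (⋂ j, S j) := isOpen_iInter_of_finite hS
  have hIc : Conic (⋂ j, S j) := fun x hx c hc =>
    mem_iInter.2 fun j => hSc j x (mem_iInter.1 hx j) c hc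
  have hhom : PosHom2 (rootSumSq Lf i) (⋂ j, S j) := by
    intro x hx c hc
    have h1 : ∀ j, Lf j (c • x) = c ^ 2 * Lf j x := fun j => hh j x (mem_iInter.1 hx j) c hc
    have hc2 : c ^ 2 ≠ 0 := by positivity
    simp only [rootSumSq, h1, mul_div_mul_left _ _ hc2]
    ring
  refine ⟨{x | ∃ U, IsOpen U ∧ x ∈ U ∧ U ⊆ ⋂ j, S j ∧ ContDiffOn ℝ ∞ (rootSumSq Lf i) U},
    ?_, ?_, ?_, ?_, ?_, ?_⟩
  · refine isOpen_iff_mem_nhds.2 fun x ⟨U, hU, hx, hUS, hUc⟩ => ?_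
    filter_upwards [hU.mem_nhds hx] with y hy using ⟨U, hU, hy, hUS, hUc⟩
  · rintro x ⟨U, hU, hx, hUS, hUc⟩ c hc
    refine ⟨(fun y => c⁻¹ • y) ⁻¹' U, hU.preimage (by fun_prop), ?_, fun y hy => ?_, ?_⟩
    · simpa [smul_smul, hc.ne'] using hx
    · have := hIc _ (hUS hy) c hc
      rwa [smul_inv_smul₀ hc.ne'] at this
    · have h1 : ContDiffOn ℝ ∞ (fun y => c ^ 2 * rootSumSq Lf i (c⁻¹ • y))
          ((fun y => c⁻¹ • y) ⁻¹' U) :=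
        contDiffOn_const.mul (hUc.comp (by fun_prop) fun y hy => hy)
      refine h1.congr fun y hy => ?_
      rw [← hhom _ (hUS hy) c hc, smul_inv_smul₀ hc.ne']
  · rintro ⟨U, -, h0, hUS, -⟩
    exact hS0 i (mem_iInter.1 (hUS h0) i)
  · intro x hx
    obtain ⟨U, hU, hxU, hUc⟩ := exists_contDiffOn hLf i hx
    exact ⟨U ∩ ⋂ j, S j, hU.inter hI, ⟨hxU, mem_iInter.2 fun j => hAS j hx⟩, inter_subset_right,
      hUc.mono inter_subset_left⟩
  · rintro x ⟨U, hU, hx, -, hUc⟩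
    exact (hUc.contDiffAt (hU.mem_nhds hx)).contDiffWithinAt
  · rintro x ⟨U, -, hx, hUS, -⟩
    exact hhom x (hUS hx)

theorem pos (hLf : ∀ j, IsProperLMNorm (Lf j) A) (i : ι) (hv : v ∈ A) :
    0 < rootSumSq Lf i v := by
  rw [eq_of_mem hLf i ((hLf i).mem_of_mem hv)]
  have := Finset.sum_pos (s := Finset.univ)
    (fun j _ => Real.sqrt_pos.2 ((hLf j).pos v hv)) ⟨i, Finset.mem_univ i⟩
  positivity

theorem eq_zero (hLf : ∀ j, IsProperLMNorm (Lf j) A) (i : ι) (hv : v ∈ (closure A \ {0}) \ A) :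
    rootSumSq Lf i v = 0 := by
  simp [rootSumSq, (hLf i).zero_on_bd v hv]

theorem fderiv_fderiv_neg_of_mem [FiniteDimensional ℝ V] (hLf : ∀ j, IsProperLMNorm (Lf j) A)
    (i : ι) (hv : v ∈ A) {u : V} (hvu : fderiv ℝ (rootSumSq Lf i) v u = 0)
    (hu : ∀ c : ℝ, u ≠ c • v) : fderiv ℝ (fderiv ℝ (rootSumSq Lf i)) v u u < 0 := by
  have hF := fun j => (hLf j).contDiffAt_sqrt hv
  set F : V → ℝ := fun x => ∑ j, √(Lf j x) with hFdef
  have hFs : ContDiffAt ℝ ∞ F v := ContDiffAt.sum fun j _ => hF j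
  have hne : (Finset.univ : Finset ι).Nonempty := ⟨i, Finset.mem_univ i⟩
  have hFv : 0 < F v := Finset.sum_pos (fun j _ => Real.sqrt_pos.2 ((hLf j).pos v hv)) hne
  have heq : rootSumSq Lf i =ᶠ[𝓝 v] fun x => F x * F x := by
    filter_upwards [(hLf i).isOpen.mem_nhds hv] with x hx
    rw [eq_of_mem hLf i ((hLf i).mem_of_mem hx), sq]
  have hF1 := hFs.eventually_hasFDerivAt.self_of_nhds
  have hdF : fderiv ℝ F v u = 0 := by
    rw [heq.fderiv_eq, (hF1.fun_mul hF1).fderiv] at hvu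
    simpa [hFv.ne'] using hvu
  rw [heq.fderiv.fderiv_eq, fderiv_fderiv_mul_apply hFs hFs, hdF]
  have hneg : fderiv ℝ (fderiv ℝ F) v u u < 0 := by
    rw [fderiv_fderiv_sum_apply hF]
    exact Finset.sum_neg (fun j _ => (hLf j).fderiv_fderiv_sqrt_neg hv hu) hne
  nlinarith [mul_neg_of_pos_of_neg hFv hneg]

theorem isProperLMNorm [FiniteDimensional ℝ V] (hLf : ∀ j, IsProperLMNorm (Lf j) A) (i : ι) :
    IsProperLMNorm (rootSumSq Lf i) A where
  nonempty := (hLf i).nonempty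
  zero_not_mem := (hLf i).zero_not_mem
  isOpen := (hLf i).isOpen
  isConnected := (hLf i).isConnected
  conic := (hLf i).conic
  pos _ hv := pos hLf i hv
  zero_on_bd _ hv := eq_zero hLf i hv
  smooth_ext := exists_smooth_ext hLf i
  lorentz v hv := by
    obtain ⟨S, hS, hSc, -, hAS, hN, hh⟩ := exists_smooth_ext hLf i
    have hNv : ContDiffAt ℝ ∞ (rootSumSq Lf i) v := hN.contDiffAt (hS.mem_nhds (hAS hv))
    have hT := fderiv_fderiv_apply_self_of_posHom2 hS hSc hN hh (hAS hv)
    have hvv := fderiv_apply_self_of_posHom2 hS hN hh (hAS hv)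
    have hsymm := fun a b => (hNv.isSymmSndFDerivAt minSmoothness_two_le_infty) a b
    by_cases hA : v ∈ A
    · have hpos := pos hLf i hA
      refine isLorentzForm_of_neg_of_orthogonal (v := v) hsymm ?_ (fun h0 => ?_)
        (fun u hvu hu => fderiv_fderiv_neg_of_mem hLf i hA (hT ▸ hvu) hu)
      · rw [hT, hvv]
        linarith
      · rw [← hT, h0, zero_apply] at hvv
        linarith
    · obtain ⟨W, H, hW, hvW, hH, hHv, heq⟩ := exists_eq_mul hLf i hv
      have hev : rootSumSq Lf i =ᶠ[𝓝 v] fun x => H x * Lf i x :=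
        eventually_of_mem (hW.mem_nhds hvW) heq
      have hHs := hH.contDiffAt (hW.mem_nhds hvW)
      have hLs := (hLf i).contDiffAt hv
      have hL0 := (hLf i).zero_on_bd v ⟨hv, hA⟩
      have hd : fderiv ℝ (rootSumSq Lf i) v = H v • fderiv ℝ (Lf i) v := by
        rw [hev.fderiv_eq, (hHs.eventually_hasFDerivAt.self_of_nhds.fun_mul
          hLs.eventually_hasFDerivAt.self_of_nhds).fderiv, hL0, zero_smul, add_zero]
      refine isLorentzForm_of_neg_of_orthogonal (v := v) hsymm ?_ ?_ fun u hvu hu => ?_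
      · rw [hT, hvv, eq_zero hLf i ⟨hv, hA⟩, mul_zero]
      · rw [hT, hd]
        exact smul_ne_zero hHv.ne' ((hLf i).fderiv_ne_zero hv)
      · rw [hT, hd] at hvu
        have hdu : fderiv ℝ (Lf i) v u = 0 := by simpa [hHv.ne'] using hvu
        rw [hev.fderiv.fderiv_eq, fderiv_fderiv_mul_apply hHs hLs, hdu, hL0]
        simpa using mul_neg_of_pos_of_neg hHv ((hLf i).fderiv_fderiv_apply_neg hv hdu hu)

end rootSumSq

/-- the square of a sum of square roots of properly Lorentz-Minkowski
norms sharing the cone domain `A` is again (after local smooth extension) a properly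
Lorentz-Minkowski norm with cone domain `A`. -/
theorem stmt_4 [FiniteDimensional ℝ V] (hn : 2 ≤ finrank ℝ V)
    (k : ℕ) (hk : 1 ≤ k) (Lf : Fin k → V → ℝ) (A : Set V)
    (hLf : ∀ j : Fin k, IsProperLMNorm (Lf j) A)
    (L : V → ℝ) (hLdef : ∀ v : V, L v = (∑ j : Fin k, Real.sqrt (Lf j v)) ^ 2) :
    -- (a) local smooth extensions exist at every point of the closed cone domain
    (∀ v ∈ closure A \ {0}, ∃ (U : Set V) (Lext : V → ℝ),
        IsOpen U ∧ v ∈ U ∧ ContDiffOn ℝ (⊤ : ℕ∞) Lext U ∧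
        EqOn Lext L (U ∩ (closure A \ {0}))) ∧
    -- (b) every local smooth extension has Lorentzian fundamental tensor on Ā
    (∀ (U : Set V) (Lext : V → ℝ), IsOpen U → ContDiffOn ℝ (⊤ : ℕ∞) Lext U →
        EqOn Lext L (U ∩ (closure A \ {0})) →
        ∀ v ∈ U ∩ (closure A \ {0}), IsLorentzForm (fundTensor Lext v)) ∧
    -- in particular, L (suitably extended) is a properly Lorentz-Minkowski norm
    (∃ Lext : V → ℝ, EqOn Lext L (closure A \ {0}) ∧ IsProperLMNorm Lext A) := by
  have hN := rootSumSq.isProperLMNorm hLf ⟨0, hk⟩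
  have heq : EqOn (rootSumSq Lf ⟨0, hk⟩) L (closure A \ {0}) := fun v hv => by
    rw [rootSumSq.eq_of_mem hLf _ hv, hLdef]
  obtain ⟨S, hS, -, -, hAS, hNS, -⟩ := hN.smooth_ext
  refine ⟨fun v hv => ⟨S, _, hS, hAS hv, hNS, heq.mono inter_subset_right⟩, ?_, _, heq, hN⟩
  intro U M hU hM hML v hv
  refine hNS.isLorentzForm_of_eqOn hN.isOpen hS hU hM (hAS hv.2) hv.1 hv.2.1 (fun x hx => ?_)
    (hN.lorentz v hv.2)
  have hx' := hN.mem_of_mem hx.2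
  rw [hML ⟨hx.1.2, hx'⟩, heq hx']
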